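/- Let x_0, …, x_{2n−1} be points in convex position in cyclic order and r_1, r_3, …, r_{2n−1} points such that x_i, x_j, r_k are collinear iff i + j + k ≡ 0 (mod 2n) for odd k. Then there is a cubic curve containing all points x_0, …, x_{2n−1} and r_1, r_3, …, r_{2n−1}. -/

import Mathlib

abbrev Pt := Fin 2 → ℝ

/-- Signed area determinant of three points (positive iff counterclockwise). -/
def det3 (a b c : Pt) : ℝ :=
  (b 0 - a 0) * (c 1 - a 1) - (b 1 - a 1) * (c 0 - a 0)

def IsAff (L : Pt → ℝ) : Prop := ∃ a b c : ℝ, ∀ p, L p = a * p 0 + b * p 1 + c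

def IsQuad (Q : Pt → ℝ) : Prop := ∃ a b c d e f : ℝ, ∀ p,
  Q p = a + b * p 0 + c * p 1 + d * p 0 ^ 2 + e * p 0 * p 1 + f * p 1 ^ 2

def cubEval (c : Fin 10 → ℝ) (p : Pt) : ℝ :=
  c 0 + c 1 * p 0 + c 2 * p 1 + c 3 * p 0 ^ 2 + c 4 * (p 0 * p 1) + c 5 * p 1 ^ 2
    + c 6 * p 0 ^ 3 + c 7 * (p 0 ^ 2 * p 1) + c 8 * (p 0 * p 1 ^ 2) + c 9 * p 1 ^ 3

def IsCub (F : Pt → ℝ) : Prop := ∃ c : Fin 10 → ℝ, ∀ p, F p = cubEval c p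

def swp (p : Pt) : Pt := ![p 1, p 0]

lemma swp_swp (p : Pt) : swp (swp p) = p := by
  ext i; fin_cases i <;> simp [swp]

lemma quad_roots {A B C u v w : ℝ} (huv : u ≠ v) (huw : u ≠ w) (hvw : v ≠ w)
    (h1 : A + B * u + C * u ^ 2 = 0) (h2 : A + B * v + C * v ^ 2 = 0)
    (h3 : A + B * w + C * w ^ 2 = 0) : A = 0 ∧ B = 0 ∧ C = 0 := by
  have e1 : B + C * (u + v) = 0 := by
    apply mul_left_cancel₀ (sub_ne_zero.2 huv); linear_combination h1 - h2
  have e2 : B + C * (u + w) = 0 := by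
    apply mul_left_cancel₀ (sub_ne_zero.2 huw); linear_combination h1 - h3
  have hC : C = 0 := by
    apply mul_left_cancel₀ (sub_ne_zero.2 hvw); linear_combination e1 - e2
  subst hC
  have hB : B = 0 := by linarith
  subst hB
  exact ⟨by linarith, rfl, rfl⟩

lemma cub_roots {A B C D u v w t : ℝ} (huv : u ≠ v) (huw : u ≠ w) (hvw : v ≠ w)
    (hut : u ≠ t) (hvt : v ≠ t) (hwt : w ≠ t)
    (h1 : A + B * u + C * u ^ 2 + D * u ^ 3 = 0) (h2 : A + B * v + C * v ^ 2 + D * v ^ 3 = 0)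
    (h3 : A + B * w + C * w ^ 2 + D * w ^ 3 = 0) (h4 : A + B * t + C * t ^ 2 + D * t ^ 3 = 0) :
    A = 0 ∧ B = 0 ∧ C = 0 ∧ D = 0 := by
  have e1 : (B + C * t + D * t ^ 2) + (C + D * t) * u + D * u ^ 2 = 0 := by
    apply mul_left_cancel₀ (sub_ne_zero.2 hut); linear_combination h1 - h4
  have e2 : (B + C * t + D * t ^ 2) + (C + D * t) * v + D * v ^ 2 = 0 := by
    apply mul_left_cancel₀ (sub_ne_zero.2 hvt); linear_combination h2 - h4
  have e3 : (B + C * t + D * t ^ 2) + (C + D * t) * w + D * w ^ 2 = 0 := by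
    apply mul_left_cancel₀ (sub_ne_zero.2 hwt); linear_combination h3 - h4
  obtain ⟨a, b, c⟩ := quad_roots huv huw hvw e1 e2 e3
  subst c
  have hC : C = 0 := by linarith
  subst hC
  have hB : B = 0 := by linarith
  subst hB
  exact ⟨by linarith, rfl, rfl, rfl⟩

/-- on a non-vertical line, points are determined by abscissa -/
lemma ne_of_line {a b c : ℝ} (hb : b ≠ 0) {p q : Pt} (hpq : p ≠ q)
    (hp : a * p 0 + b * p 1 + c = 0) (hq : a * q 0 + b * q 1 + c = 0) : p 0 ≠ q 0 := by
  intro h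
  apply hpq
  have h1 : p 1 = q 1 := by
    apply mul_left_cancel₀ hb; rw [h] at hp; linarith
  ext i; fin_cases i
  · exact h
  · exact h1

lemma line_y {a b c : ℝ} (hb : b ≠ 0) {p : Pt}
    (hp : a * p 0 + b * p 1 + c = 0) : p 1 = (-a / b) * p 0 + (-c / b) := by
  field_simp; linarith

lemma cub_div_aux {c : Fin 10 → ℝ} {a b k : ℝ} (hb : b ≠ 0) {p q s t : Pt}
    (hpq : p ≠ q) (hps : p ≠ s) (hqs : q ≠ s) (hpt : p ≠ t) (hqt : q ≠ t) (hst : s ≠ t)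
    (hp : a * p 0 + b * p 1 + k = 0) (hq : a * q 0 + b * q 1 + k = 0)
    (hs : a * s 0 + b * s 1 + k = 0) (ht : a * t 0 + b * t 1 + k = 0)
    (fp : cubEval c p = 0) (fq : cubEval c q = 0) (fs : cubEval c s = 0)
    (ft : cubEval c t = 0) :
    ∃ Q, IsQuad Q ∧ ∀ z : Pt, cubEval c z = (a * z 0 + b * z 1 + k) * Q z := by
  have n1 := ne_of_line hb hpq hp hq
  have n2 := ne_of_line hb hps hp hs
  have n3 := ne_of_line hb hqs hq hs
  have n4 := ne_of_line hb hpt hp ht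
  have n5 := ne_of_line hb hqt hq ht
  have n6 := ne_of_line hb hst hs ht
  have yp := line_y hb hp
  have yq := line_y hb hq
  have ys := line_y hb hs
  have yt := line_y hb ht
  obtain ⟨m, hm⟩ : ∃ m, m = -a / b := ⟨_, rfl⟩
  obtain ⟨l, hl⟩ : ∃ l, l = -k / b := ⟨_, rfl⟩
  rw [← hm, ← hl] at yp yq ys yt
  have ha : a = - b * m := by rw [hm]; field_simp
  have hk : k = - b * l := by rw [hl]; field_simp
  have key : ∀ z : Pt, z 1 = m * z 0 + l → cubEval c z = 0 →
      (c 0 + c 2 * l + c 5 * l ^ 2 + c 9 * l ^ 3)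
      + (c 1 + c 2 * m + c 4 * l + 2 * c 5 * m * l + c 8 * l ^ 2 + 3 * c 9 * m * l ^ 2) * z 0
      + (c 3 + c 4 * m + c 5 * m ^ 2 + c 7 * l + 2 * c 8 * m * l + 3 * c 9 * m ^ 2 * l) * z 0 ^ 2
      + (c 6 + c 7 * m + c 8 * m ^ 2 + c 9 * m ^ 3) * z 0 ^ 3 = 0 := by
    intro z hz h
    unfold cubEval at h
    rw [hz] at h
    linear_combination h
  obtain ⟨r0, r1, r2, r3⟩ := cub_roots n1 n2 n3 n4 n5 n6 (key p yp fp) (key q yq fq)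
    (key s ys fs) (key t yt ft)
  refine ⟨fun z => ((c 2 + c 5 * l + c 9 * l ^ 2)
      + (c 4 + c 5 * m + c 8 * l + 2 * c 9 * m * l) * z 0 + (c 5 + c 9 * l) * z 1
      + (c 7 + c 8 * m + c 9 * m ^ 2) * z 0 ^ 2 + (c 8 + c 9 * m) * z 0 * z 1
      + c 9 * z 1 ^ 2) / b, ⟨(c 2 + c 5 * l + c 9 * l ^ 2) / b,
      (c 4 + c 5 * m + c 8 * l + 2 * c 9 * m * l) / b, (c 5 + c 9 * l) / b,
      (c 7 + c 8 * m + c 9 * m ^ 2) / b, (c 8 + c 9 * m) / b, c 9 / b, ?_⟩, ?_⟩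
  · intro z; ring
  · intro z
    rw [ha, hk]
    field_simp
    unfold cubEval
    linear_combination r0 + r1 * z 0 + r2 * z 0 ^ 2 + r3 * z 0 ^ 3

lemma quad_div_aux {c0 c1 c2 c3 c4 c5 : ℝ} {a b k : ℝ} (hb : b ≠ 0) {p q s : Pt}
    (hpq : p ≠ q) (hps : p ≠ s) (hqs : q ≠ s)
    (hp : a * p 0 + b * p 1 + k = 0) (hq : a * q 0 + b * q 1 + k = 0)
    (hs : a * s 0 + b * s 1 + k = 0)
    (fp : c0 + c1 * p 0 + c2 * p 1 + c3 * p 0 ^ 2 + c4 * p 0 * p 1 + c5 * p 1 ^ 2 = 0)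
    (fq : c0 + c1 * q 0 + c2 * q 1 + c3 * q 0 ^ 2 + c4 * q 0 * q 1 + c5 * q 1 ^ 2 = 0)
    (fs : c0 + c1 * s 0 + c2 * s 1 + c3 * s 0 ^ 2 + c4 * s 0 * s 1 + c5 * s 1 ^ 2 = 0) :
    ∃ R, IsAff R ∧ ∀ z : Pt,
      c0 + c1 * z 0 + c2 * z 1 + c3 * z 0 ^ 2 + c4 * z 0 * z 1 + c5 * z 1 ^ 2
        = (a * z 0 + b * z 1 + k) * R z := by
  have n1 := ne_of_line hb hpq hp hq
  have n2 := ne_of_line hb hps hp hs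
  have n3 := ne_of_line hb hqs hq hs
  have yp := line_y hb hp
  have yq := line_y hb hq
  have ys := line_y hb hs
  obtain ⟨m, hm⟩ : ∃ m, m = -a / b := ⟨_, rfl⟩
  obtain ⟨l, hl⟩ : ∃ l, l = -k / b := ⟨_, rfl⟩
  rw [← hm, ← hl] at yp yq ys
  have ha : a = - b * m := by rw [hm]; field_simp
  have hk : k = - b * l := by rw [hl]; field_simp
  have key : ∀ z : Pt, z 1 = m * z 0 + l →
      c0 + c1 * z 0 + c2 * z 1 + c3 * z 0 ^ 2 + c4 * z 0 * z 1 + c5 * z 1 ^ 2 = 0 →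
      (c0 + c2 * l + c5 * l ^ 2) + (c1 + c2 * m + c4 * l + 2 * c5 * m * l) * z 0
      + (c3 + c4 * m + c5 * m ^ 2) * z 0 ^ 2 = 0 := by
    intro z hz h
    rw [hz] at h
    linear_combination h
  obtain ⟨r0, r1, r2⟩ := quad_roots n1 n2 n3 (key p yp fp) (key q yq fq) (key s ys fs)
  refine ⟨fun z => ((c4 + c5 * m) * z 0 + c5 * z 1 + (c2 + c5 * l)) / b,
    ⟨(c4 + c5 * m) / b, c5 / b, (c2 + c5 * l) / b, ?_⟩, ?_⟩
  · intro z; ring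
  · intro z
    rw [ha, hk]
    field_simp
    linear_combination r0 + r1 * z 0 + r2 * z 0 ^ 2

lemma swp_ne {p q : Pt} (h : p ≠ q) : swp p ≠ swp q := fun e => h (by
  rw [← swp_swp p, e, swp_swp])

lemma cub_div {F L : Pt → ℝ} (hF : IsCub F) (hL : IsAff L) {p q s t o : Pt} (ho : L o ≠ 0)
    (hpq : p ≠ q) (hps : p ≠ s) (hqs : q ≠ s) (hpt : p ≠ t) (hqt : q ≠ t) (hst : s ≠ t)
    (hp : L p = 0) (hq : L q = 0) (hs : L s = 0) (ht : L t = 0)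
    (fp : F p = 0) (fq : F q = 0) (fs : F s = 0) (ft : F t = 0) :
    ∃ Q, IsQuad Q ∧ ∀ z : Pt, F z = L z * Q z := by
  obtain ⟨a, b, k, hL⟩ := hL
  obtain ⟨c, hF⟩ := hF
  simp only [hL, hF] at *
  by_cases hb : b = 0
  · have ha : a ≠ 0 := by
      rintro rfl
      subst hb
      apply ho; linarith
    have hc : ∀ z, cubEval ![c 0, c 2, c 1, c 5, c 4, c 3, c 9, c 8, c 7, c 6] (swp z)
        = cubEval c z := by
      intro z
      simp [cubEval, swp]
      ring
    obtain ⟨Q, ⟨q0, q1, q2, q3, q4, q5, hQ⟩, h⟩ := cub_div_aux (a := b) (b := a) (k := k)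
      (c := ![c 0, c 2, c 1, c 5, c 4, c 3, c 9, c 8, c 7, c 6])
      ha (swp_ne hpq) (swp_ne hps) (swp_ne hqs) (swp_ne hpt) (swp_ne hqt) (swp_ne hst)
      (by simp [swp]; linarith) (by simp [swp]; linarith) (by simp [swp]; linarith)
      (by simp [swp]; linarith) (by rw [hc, fp]) (by rw [hc, fq]) (by rw [hc, fs])
      (by rw [hc, ft])
    refine ⟨fun z => Q (swp z), ⟨q0, q2, q1, q5, q4, q3, ?_⟩, ?_⟩
    · intro z
      simp only [hQ]; simp [swp]; ring
    · intro z
      rw [← hc, h]; simp [swp]; left; ring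
  · exact cub_div_aux hb hpq hps hqs hpt hqt hst hp hq hs ht fp fq fs ft

lemma quad_div {F L : Pt → ℝ} (hF : IsQuad F) (hL : IsAff L) {p q s o : Pt} (ho : L o ≠ 0)
    (hpq : p ≠ q) (hps : p ≠ s) (hqs : q ≠ s)
    (hp : L p = 0) (hq : L q = 0) (hs : L s = 0)
    (fp : F p = 0) (fq : F q = 0) (fs : F s = 0) :
    ∃ R, IsAff R ∧ ∀ z : Pt, F z = L z * R z := by
  obtain ⟨a, b, k, hL⟩ := hL
  obtain ⟨c0, c1, c2, c3, c4, c5, hF⟩ := hF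
  simp only [hL, hF] at *
  by_cases hb : b = 0
  · have ha : a ≠ 0 := by
      rintro rfl
      subst hb
      apply ho; linarith
    obtain ⟨Q, ⟨q0, q1, q2, hQ⟩, h⟩ := quad_div_aux (a := b) (b := a) (k := k)
      (c0 := c0) (c1 := c2) (c2 := c1) (c3 := c5) (c4 := c4) (c5 := c3)
      ha (swp_ne hpq) (swp_ne hps) (swp_ne hqs)
      (by simp [swp]; linarith) (by simp [swp]; linarith) (by simp [swp]; linarith)
      (by simp [swp]; linarith) (by simp [swp]; linarith) (by simp [swp]; linarith)
    refine ⟨fun z => Q (swp z), ⟨q1, q0, q2, ?_⟩, ?_⟩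
    · intro z
      simp only [hQ]; simp [swp]; ring
    · intro z
      have := h (swp z)
      simp [swp] at this ⊢
      linear_combination this
  · exact quad_div_aux hb hpq hps hqs hp hq hs fp fq fs

lemma aff_col {R L : Pt → ℝ} (hR : IsAff R) (hL : IsAff L) {p q s o : Pt} (ho : L o ≠ 0)
    (hpq : p ≠ q) (hp : L p = 0) (hq : L q = 0) (hs : L s = 0)
    (fp : R p = 0) (fq : R q = 0) : R s = 0 := by
  obtain ⟨a, b, k, hL⟩ := hL
  obtain ⟨c0, c1, c2, hR⟩ := hR
  simp only [hL, hR] at *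
  have e1 : a * (p 0 - q 0) + b * (p 1 - q 1) = 0 := by linarith
  have e2 : a * (p 0 - s 0) + b * (p 1 - s 1) = 0 := by linarith
  have e3 : c0 * (p 0 - q 0) + c1 * (p 1 - q 1) = 0 := by linarith
  have hne : p 0 - q 0 ≠ 0 ∨ p 1 - q 1 ≠ 0 := by
    by_contra! h
    apply hpq
    ext i; fin_cases i
    · simpa using sub_eq_zero.1 h.1
    · simpa using sub_eq_zero.1 h.2
  have hab : a ≠ 0 ∨ b ≠ 0 := by
    by_contra! h
    apply ho
    obtain ⟨rfl, rfl⟩ := h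
    linarith
  have d1 : (p 0 - q 0) * (p 1 - s 1) - (p 1 - q 1) * (p 0 - s 0) = 0 := by
    rcases hab with h | h
    · apply mul_left_cancel₀ h; linear_combination e1 * (p 1 - s 1) - e2 * (p 1 - q 1)
    · apply mul_left_cancel₀ h; linear_combination e2 * (p 0 - q 0) - e1 * (p 0 - s 0)
  have : c0 * (p 0 - s 0) + c1 * (p 1 - s 1) = 0 := by
    rcases hne with h | h
    · apply mul_left_cancel₀ h; linear_combination e3 * (p 0 - s 0) + c1 * d1
    · apply mul_left_cancel₀ h; linear_combination e3 * (p 1 - s 1) - c0 * d1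
  linarith

lemma aff_line {L : Pt → ℝ} (hL : IsAff L) (p q : Pt) (t : ℝ) :
    L (fun i => p i + t * (q i - p i)) = (1 - t) * L p + t * L q := by
  obtain ⟨a, b, k, hL⟩ := hL
  simp only [hL]; ring

/-- Chasles / Cayley–Bacharach for two triples of lines. -/
lemma chasles {F : Pt → ℝ} (hF : IsCub F) {l m : Fin 3 → Pt → ℝ} (P : Fin 3 → Fin 3 → Pt)
    (hl : ∀ i, IsAff (l i)) (hm : ∀ i, IsAff (m i))
    (hlP : ∀ i k j, l i (P k j) = 0 ↔ i = k)
    (hmP : ∀ j i k, m j (P i k) = 0 ↔ j = k)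
    (hP : ∀ i j, (i, j) ≠ (2, 2) → F (P i j) = 0) : F (P 2 2) = 0 := by
  have hne : ∀ i j k, j ≠ k → P i j ≠ P i k := by
    intro i j k hjk h
    have h1 := (hmP j i j).2 rfl
    rw [h] at h1
    exact hjk ((hmP j i k).1 h1)
  -- a fourth point
  obtain ⟨T, hT⟩ : ∃ T : Pt, l 0 T = 0 ∧ ∀ j, m j T ≠ 0 := by
    have hfin : ∀ j, ({t : ℝ | m j (fun i => P 0 0 i + t * (P 0 1 i - P 0 0 i)) = 0}).Finite := by
      intro j
      apply Set.Subsingleton.finite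
      intro t ht u hu
      simp only [Set.mem_ofPred_eq, aff_line (hm j)] at ht hu
      by_contra htu
      have hd : m j (P 0 1) = m j (P 0 0) := by
        apply mul_left_cancel₀ (sub_ne_zero.2 htu); linear_combination ht - hu
      rw [hd] at ht
      have h0 : m j (P 0 0) = 0 := by linear_combination ht
      have h1 := (hmP j 0 0).1 h0
      rw [h0] at hd
      have h2 := (hmP j 0 1).1 hd
      rw [h1] at h2
      exact absurd h2 (by decide)
    obtain ⟨t, ht⟩ := (Set.finite_iUnion hfin).exists_notMem
    simp only [Set.mem_iUnion, Set.mem_ofPred_eq, not_exists] at ht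
    refine ⟨_, ?_, ht⟩
    rw [aff_line (hl 0), (hlP 0 0 0).2 rfl, (hlP 0 0 1).2 rfl]; ring
  obtain ⟨hT0, hT⟩ := hT
  have hTne : ∀ j, P 0 j ≠ T := by
    intro j h
    apply hT j
    rw [← h]; exact (hmP j 0 j).2 rfl
  have hM : m 0 T * m 1 T * m 2 T ≠ 0 := mul_ne_zero (mul_ne_zero (hT 0) (hT 1)) (hT 2)
  set lam := F T / (m 0 T * m 1 T * m 2 T) with hlam
  have hG : IsCub (fun z => F z - lam * (m 0 z * m 1 z * m 2 z)) := by
    obtain ⟨c, hF⟩ := hF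
    obtain ⟨a0, b0, c0, h0⟩ := hm 0
    obtain ⟨a1, b1, c1, h1⟩ := hm 1
    obtain ⟨a2, b2, c2, h2⟩ := hm 2
    refine ⟨![c 0 - lam * (c0 * c1 * c2),
      c 1 - lam * (a0 * c1 * c2 + c0 * a1 * c2 + c0 * c1 * a2),
      c 2 - lam * (b0 * c1 * c2 + c0 * b1 * c2 + c0 * c1 * b2),
      c 3 - lam * (a0 * a1 * c2 + a0 * c1 * a2 + c0 * a1 * a2),
      c 4 - lam * (a0 * b1 * c2 + a0 * c1 * b2 + b0 * a1 * c2 + b0 * c1 * a2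
        + c0 * a1 * b2 + c0 * b1 * a2),
      c 5 - lam * (b0 * b1 * c2 + b0 * c1 * b2 + c0 * b1 * b2),
      c 6 - lam * (a0 * a1 * a2),
      c 7 - lam * (a0 * a1 * b2 + a0 * b1 * a2 + b0 * a1 * a2),
      c 8 - lam * (a0 * b1 * b2 + b0 * a1 * b2 + b0 * b1 * a2),
      c 9 - lam * (b0 * b1 * b2)], ?_⟩
    intro z
    simp only [hF, h0, h1, h2]
    simp [cubEval]
    ring
  have hMP : ∀ i j, m 0 (P i j) * m 1 (P i j) * m 2 (P i j) = 0 := by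
    intro i j
    have := (hmP j i j).2 rfl
    fin_cases j <;> simp at this <;> simp [this]
  have hGP : ∀ i j, (i, j) ≠ (2, 2) →
      F (P i j) - lam * (m 0 (P i j) * m 1 (P i j) * m 2 (P i j)) = 0 := by
    intro i j hij
    rw [hMP, hP i j hij]; ring
  have hl' : ∀ i k j, i ≠ k → l i (P k j) ≠ 0 := fun i k j h e => h ((hlP i k j).1 e)
  obtain ⟨Q, hQ, hFQ⟩ := cub_div hG (hl 0) (o := P 1 0) (hl' 0 1 0 (by decide))
    (hne 0 0 1 (by decide)) (hne 0 0 2 (by decide)) (hne 0 1 2 (by decide))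
    (hTne 0) (hTne 1) (hTne 2) ((hlP 0 0 0).2 rfl) ((hlP 0 0 1).2 rfl) ((hlP 0 0 2).2 rfl) hT0
    (hGP 0 0 (by decide)) (hGP 0 1 (by decide)) (hGP 0 2 (by decide))
    (by simp only [hlam]; rw [div_mul_cancel₀ _ hM, sub_self])
  have hQP : ∀ i j, (i, j) ≠ (2, 2) → 0 ≠ i → Q (P i j) = 0 := by
    intro i j hij hi
    have h := hFQ (P i j)
    simp only [hGP i j hij] at h
    exact (mul_eq_zero.1 h.symm).resolve_left (hl' 0 i j hi)
  obtain ⟨R, hR, hQR⟩ := quad_div hQ (hl 1) (o := P 0 0) (hl' 1 0 0 (by decide))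
    (hne 1 0 1 (by decide)) (hne 1 0 2 (by decide)) (hne 1 1 2 (by decide))
    ((hlP 1 1 0).2 rfl) ((hlP 1 1 1).2 rfl) ((hlP 1 1 2).2 rfl)
    (hQP 1 0 (by decide) (by decide)) (hQP 1 1 (by decide) (by decide))
    (hQP 1 2 (by decide) (by decide))
  have hRP : ∀ j, j ≠ 2 → R (P 2 j) = 0 := by
    intro j hj
    have h := hQR (P 2 j)
    rw [hQP 2 j (by simpa using hj) (by decide)] at h
    exact (mul_eq_zero.1 h.symm).resolve_left (hl' 1 2 j (by decide))
  have hR2 : R (P 2 2) = 0 := aff_col hR (hl 2) (hl' 2 0 0 (by decide)) (hne 2 0 1 (by decide))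
    ((hlP 2 2 0).2 rfl) ((hlP 2 2 1).2 rfl) ((hlP 2 2 2).2 rfl)
    (hRP 0 (by decide)) (hRP 1 (by decide))
  have h := hFQ (P 2 2)
  rw [hQR, hR2] at h
  simp only [hMP] at h
  linarith

lemma det3_aff (a b : Pt) : IsAff (det3 a b) :=
  ⟨-(b 1 - a 1), b 0 - a 0, -(b 0 - a 0) * a 1 + (b 1 - a 1) * a 0, fun p => by
    unfold det3; ring⟩

lemma collinear_iff_det3 {a b c : Pt} (hab : a ≠ b) :
    Collinear ℝ ({a, b, c} : Set Pt) ↔ det3 a b c = 0 := by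
  rw [collinear_iff_of_mem (p₀ := a) (by simp)]
  constructor
  · rintro ⟨v, hv⟩
    obtain ⟨s, hs⟩ := hv b (by simp)
    obtain ⟨t, ht⟩ := hv c (by simp)
    rw [hs, ht]
    simp [det3]
    ring
  · intro h
    refine ⟨b - a, ?_⟩
    have hne : b 0 - a 0 ≠ 0 ∨ b 1 - a 1 ≠ 0 := by
      by_contra! h
      apply hab
      ext i; fin_cases i
      · simpa using (sub_eq_zero.1 h.1).symm
      · simpa using (sub_eq_zero.1 h.2).symm
    unfold det3 at h
    intro p hp
    simp only [Set.mem_insert_iff, Set.mem_singleton_iff] at hp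
    rcases hp with rfl | rfl | rfl
    · exact ⟨0, by simp⟩
    · exact ⟨1, by simp⟩
    · rcases hne with h0 | h0
      · refine ⟨(p 0 - a 0) / (b 0 - a 0), ?_⟩
        ext i; fin_cases i
        · simp; field_simp; ring
        · simp; field_simp; linear_combination h
      · refine ⟨(p 1 - a 1) / (b 1 - a 1), ?_⟩
        ext i; fin_cases i
        · simp; field_simp; linear_combination -h
        · simp; field_simp; ring

lemma no_between {n : ℕ} {x : ZMod (2 * n) → Pt}
    (hconv : ∀ i j : ZMod (2 * n), j ≠ i → j ≠ i + 1 → 0 < det3 (x i) (x (i + 1)) (x j))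
    {a b c : ZMod (2 * n)} (hab : a ≠ b) (hbc : b ≠ c) (hac : a ≠ c)
    (h : Wbtw ℝ (x a) (x b) (x c)) : False := by
  obtain ⟨t, ⟨ht0, ht1⟩, ht⟩ := h
  have hb : ∀ i, x b i = x a i + t * (x c i - x a i) := by
    intro i
    rw [← ht]; simp [AffineMap.lineMap_apply]; ring
  have e : ∀ u v, det3 u v (x b) = (1 - t) * det3 u v (x a) + t * det3 u v (x c) := by
    intro u v
    rw [← aff_line (det3_aff u v)]
    congr 1
    exact funext hb
  have eb := e (x b) (x (b + 1))
  have z : det3 (x b) (x (b + 1)) (x b) = 0 := by unfold det3; ring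
  have z' : det3 (x b) (x (b + 1)) (x (b + 1)) = 0 := by unfold det3; ring
  rw [z] at eb
  by_cases h1 : a = b + 1
  · have hc := hconv b c hbc.symm (by rw [← h1]; exact hac.symm)
    rw [h1, z'] at eb
    have : t = 0 := by
      have : t * det3 (x b) (x (b + 1)) (x c) = 0 := by linarith
      exact (mul_eq_zero.1 this).resolve_right hc.ne'
    have hxa : x b = x a := by ext i; rw [hb, this]; ring
    have := hconv b c hbc.symm (by rw [← h1]; exact hac.symm)
    rw [← h1, hxa] at this
    unfold det3 at this
    nlinarith
  · have ha := hconv b a hab h1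
    by_cases h2 : c = b + 1
    · rw [h2, z'] at eb
      have : 1 - t = 0 := by
        have : (1 - t) * det3 (x b) (x (b + 1)) (x a) = 0 := by linarith
        exact (mul_eq_zero.1 this).resolve_right ha.ne'
      have ht : t = 1 := by linarith
      have hxa : x b = x c := by ext i; rw [hb, ht]; ring
      rw [← h2, hxa] at ha
      unfold det3 at ha
      nlinarith
    · have hc := hconv b c hbc.symm h2
      nlinarith [mul_nonneg ht0 hc.le, mul_nonneg (sub_nonneg.2 ht1) ha.le]

lemma no_three {n : ℕ} {x : ZMod (2 * n) → Pt} (hxinj : Function.Injective x)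
    (hconv : ∀ i j : ZMod (2 * n), j ≠ i → j ≠ i + 1 → 0 < det3 (x i) (x (i + 1)) (x j))
    {a b c : ZMod (2 * n)} (hab : a ≠ b) (hbc : b ≠ c) (hac : a ≠ c) :
    det3 (x a) (x b) (x c) ≠ 0 := by
  intro h
  rw [← collinear_iff_det3 (hxinj.ne hab)] at h
  rcases h.wbtw_or_wbtw_or_wbtw with h | h | h
  · exact no_between hconv hab hbc hac h
  · exact no_between hconv hbc hac.symm hab.symm h
  · exact no_between hconv hac.symm hab hbc.symm h


@[simp] lemma det3_left (a b : Pt) : det3 a b a = 0 := by unfold det3; ring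

@[simp] lemma det3_right (a b : Pt) : det3 a b b = 0 := by unfold det3; ring

section steps

variable {F : Pt → ℝ} {y s : ℤ → Pt}

lemma stepA (hF : IsCub F)
    (hyy : ∀ a b c : ℤ, a ≠ b → b ≠ c → a ≠ c → (-10 < a - b ∧ a - b < 10) → (-10 < b - c ∧ b - c < 10) → (-10 < a - c ∧ a - c < 10) →
      det3 (y a) (y b) (y c) ≠ 0)
    (hys : ∀ a b k : ℤ, Odd k → a ≠ b → (-10 < a - b ∧ a - b < 10) → (-10 < a + b - k ∧ a + b - k < 10) →
      (det3 (y a) (y b) (s k) = 0 ↔ a + b = k))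
    (m : ℤ) (h0 : F (y m) = 0) (h1 : F (y (m + 1)) = 0) (h2 : F (y (m + 2)) = 0)
    (h3 : F (y (m + 3)) = 0) (h4 : F (y (m + 4)) = 0) (h5 : F (y (m + 5)) = 0)
    (g0 : F (s (2 * m + 3)) = 0) (g1 : F (s (2 * m + 5)) = 0) : F (s (2 * m + 7)) = 0 := by
  have o0 : Odd (2 * m + 3) := ⟨m + 1, by ring⟩
  have o1 : Odd (2 * m + 5) := ⟨m + 2, by ring⟩
  have o2 : Odd (2 * m + 7) := ⟨m + 3, by ring⟩
  refine chasles hF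
    (l := ![det3 (y (m + 1)) (y (m + 2)), det3 (y m) (y (m + 5)), det3 (y (m + 3)) (y (m + 4))])
    (m := ![det3 (y m) (y (m + 3)), det3 (y (m + 1)) (y (m + 4)), det3 (y (m + 2)) (y (m + 5))])
    ![![s (2 * m + 3), y (m + 1), y (m + 2)], ![y m, s (2 * m + 5), y (m + 5)],
      ![y (m + 3), y (m + 4), s (2 * m + 7)]] ?_ ?_ ?_ ?_ ?_
  · intro i; fin_cases i <;> exact det3_aff _ _
  · intro i; fin_cases i <;> exact det3_aff _ _
  · intro i k j
    fin_cases i <;> fin_cases k <;> fin_cases j <;> simp <;>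
    first
    | exact hyy _ _ _ (by omega) (by omega) (by omega) (by omega) (by omega) (by omega)
    | (rw [hys _ _ _ (by assumption) (by omega) (by omega) (by omega)]; omega)
  · intro i k j
    fin_cases i <;> fin_cases k <;> fin_cases j <;> simp <;>
    first
    | exact hyy _ _ _ (by omega) (by omega) (by omega) (by omega) (by omega) (by omega)
    | (rw [hys _ _ _ (by assumption) (by omega) (by omega) (by omega)]; omega)
  · intro i j hij
    fin_cases i <;> fin_cases j <;> first | assumption | exact absurd rfl hij

lemma stepB (hF : IsCub F)
    (hyy : ∀ a b c : ℤ, a ≠ b → b ≠ c → a ≠ c → (-10 < a - b ∧ a - b < 10) → (-10 < b - c ∧ b - c < 10) → (-10 < a - c ∧ a - c < 10) →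
      det3 (y a) (y b) (y c) ≠ 0)
    (hys : ∀ a b k : ℤ, Odd k → a ≠ b → (-10 < a - b ∧ a - b < 10) → (-10 < a + b - k ∧ a + b - k < 10) →
      (det3 (y a) (y b) (s k) = 0 ↔ a + b = k))
    (m : ℤ) (h0 : F (y m) = 0) (h2 : F (y (m + 2)) = 0)
    (h3 : F (y (m + 3)) = 0) (h4 : F (y (m + 4)) = 0) (h5 : F (y (m + 5)) = 0)
    (g0 : F (s (2 * m + 5)) = 0) (g1 : F (s (2 * m + 7)) = 0) (g2 : F (s (2 * m + 9)) = 0) :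
    F (y (m + 7)) = 0 := by
  have o0 : Odd (2 * m + 5) := ⟨m + 2, by ring⟩
  have o1 : Odd (2 * m + 7) := ⟨m + 3, by ring⟩
  have o2 : Odd (2 * m + 9) := ⟨m + 4, by ring⟩
  refine chasles hF
    (l := ![det3 (y m) (y (m + 5)), det3 (y (m + 3)) (y (m + 4)), det3 (y (m + 2)) (y (m + 7))])
    (m := ![det3 (y (m + 2)) (y (m + 3)), det3 (y (m + 4)) (y (m + 5)), det3 (y m) (y (m + 7))])
    ![![s (2 * m + 5), y (m + 5), y m], ![y (m + 3), y (m + 4), s (2 * m + 7)],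
      ![y (m + 2), s (2 * m + 9), y (m + 7)]] ?_ ?_ ?_ ?_ ?_
  · intro i; fin_cases i <;> exact det3_aff _ _
  · intro i; fin_cases i <;> exact det3_aff _ _
  · intro i k j
    fin_cases i <;> fin_cases k <;> fin_cases j <;> simp <;>
    first
    | exact hyy _ _ _ (by omega) (by omega) (by omega) (by omega) (by omega) (by omega)
    | (rw [hys _ _ _ (by assumption) (by omega) (by omega) (by omega)]; omega)
  · intro i k j
    fin_cases i <;> fin_cases k <;> fin_cases j <;> simp <;>
    first
    | exact hyy _ _ _ (by omega) (by omega) (by omega) (by omega) (by omega) (by omega)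
    | (rw [hys _ _ _ (by assumption) (by omega) (by omega) (by omega)]; omega)
  · intro i j hij
    fin_cases i <;> fin_cases j <;> first | assumption | exact absurd rfl hij

lemma propagate (hF : IsCub F)
    (hyy : ∀ a b c : ℤ, a ≠ b → b ≠ c → a ≠ c → (-10 < a - b ∧ a - b < 10) → (-10 < b - c ∧ b - c < 10) → (-10 < a - c ∧ a - c < 10) →
      det3 (y a) (y b) (y c) ≠ 0)
    (hys : ∀ a b k : ℤ, Odd k → a ≠ b → (-10 < a - b ∧ a - b < 10) → (-10 < a + b - k ∧ a + b - k < 10) →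
      (det3 (y a) (y b) (s k) = 0 ↔ a + b = k))
    (h0 : ∀ j : ℤ, 0 ≤ j → j ≤ 6 → F (y j) = 0) (g0 : F (s 3) = 0) (g1 : F (s 5) = 0) (m : ℕ) :
    (∀ j : ℤ, 0 ≤ j → j ≤ 6 → F (y (m + j)) = 0) ∧ F (s (2 * m + 3)) = 0 ∧
      F (s (2 * m + 5)) = 0 := by
  induction m with
  | zero => simpa using ⟨h0, g0, g1⟩
  | succ m ih =>
    obtain ⟨hy, a, b⟩ := ih
    have z0 : F (y m) = 0 := by simpa using hy 0 (by norm_num) (by norm_num)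
    have z1 := hy 1 (by norm_num) (by norm_num)
    have z2 := hy 2 (by norm_num) (by norm_num)
    have z3 := hy 3 (by norm_num) (by norm_num)
    have z4 := hy 4 (by norm_num) (by norm_num)
    have z5 := hy 5 (by norm_num) (by norm_num)
    have z6 := hy 6 (by norm_num) (by norm_num)
    have c := stepA hF hyy hys m z0 z1 z2 z3 z4 z5 a b
    have d := stepA hF hyy hys (m + 1) z1 (by convert z2 using 3; ring)
      (by convert z3 using 3; ring) (by convert z4 using 3; ring) (by convert z5 using 3; ring)
      (by convert z6 using 3; ring) (by convert b using 3; ring) (by convert c using 3; ring)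
    have e := stepB hF hyy hys m z0 z2 z3 z4 z5 b c (by convert d using 3; ring)
    refine ⟨?_, ?_, ?_⟩
    · intro j hj hj'
      by_cases h : j = 6
      · subst h
        convert e using 3; push_cast; ring
      · convert hy (j + 1) (by omega) (by omega) using 3; push_cast; ring
    · convert b using 3; push_cast; ring
    · convert c using 3; push_cast; ring

end steps

def exps : Fin 10 → (Fin 2 → ℕ) :=
  ![![0, 0], ![1, 0], ![0, 1], ![2, 0], ![1, 1], ![0, 2], ![3, 0], ![2, 1], ![1, 2], ![0, 3]]

noncomputable def toMv (c : Fin 10 → ℝ) : MvPolynomial (Fin 2) ℝ :=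
  ∑ i, MvPolynomial.monomial (Finsupp.equivFunOnFinite.symm (exps i)) (c i)

lemma toMv_eval (c : Fin 10 → ℝ) (p : Pt) : MvPolynomial.eval p (toMv c) = cubEval c p := by
  simp [toMv, MvPolynomial.eval_monomial, Finsupp.prod_fintype, Fin.sum_univ_succ, exps, cubEval]
  ring

lemma toMv_ne (c : Fin 10 → ℝ) (hc : c ≠ 0) : toMv c ≠ 0 := by
  intro h
  apply hc
  have hinj : Function.Injective exps := by decide
  ext i
  have := congrArg (MvPolynomial.coeff (Finsupp.equivFunOnFinite.symm (exps i))) h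
  simpa [toMv, MvPolynomial.coeff_sum, MvPolynomial.coeff_monomial, hinj.eq_iff] using this

lemma toMv_deg (c : Fin 10 → ℝ) : (toMv c).totalDegree ≤ 3 := by
  apply MvPolynomial.totalDegree_finsetSum_le
  intro i _
  refine (MvPolynomial.totalDegree_monomial_le _ _).trans ?_
  rw [Finsupp.sum_fintype _ _ (by simp)]
  revert i
  simp only [Fin.sum_univ_two]
  intro i _
  fin_cases i <;> simp [exps]

lemma exists_cubic (P : Fin 9 → Pt) : ∃ c : Fin 10 → ℝ, c ≠ 0 ∧ ∀ i, cubEval c (P i) = 0 := by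
  let T : (Fin 10 → ℝ) →ₗ[ℝ] (Fin 9 → ℝ) :=
    { toFun := fun c i => cubEval c (P i)
      map_add' := by intro c d; ext i; simp [cubEval]; ring
      map_smul' := by intro c d; ext i; simp [cubEval]; ring }
  have hT : LinearMap.ker T ≠ ⊥ := LinearMap.ker_ne_bot_of_finrank_lt (by simp)
  obtain ⟨c, hc, hc0⟩ := Submodule.exists_mem_ne_zero_of_ne_bot hT
  exact ⟨c, hc0, fun i => congrFun (LinearMap.mem_ker.1 hc) i⟩

theorem stmt17 (n : ℕ) (hn : 5 ≤ n) (x r : ZMod (2 * n) → Pt)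
    (hxinj : Function.Injective x)
    -- x_0, …, x_{2n-1} are in convex position in counterclockwise cyclic order:
    (hconv : ∀ i j : ZMod (2 * n), j ≠ i → j ≠ i + 1 →
      0 < det3 (x i) (x (i + 1)) (x j))
    -- collinearity structure, for odd k:
    (hcol : ∀ i j k : ZMod (2 * n), i ≠ j → Odd k.val →
      (Collinear ℝ ({x i, x j, r k} : Set Pt) ↔ i + j + k = 0)) :
    ∃ f : MvPolynomial (Fin 2) ℝ, f ≠ 0 ∧ f.totalDegree ≤ 3 ∧
      (∀ i : ZMod (2 * n), MvPolynomial.eval (x i) f = 0) ∧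
      (∀ k : ZMod (2 * n), Odd k.val → MvPolynomial.eval (r k) f = 0) := by
  have : NeZero (2 * n) := ⟨by omega⟩
  have hcast : ∀ d : ℤ, (-10 < d ∧ d < 10) → ((d : ℤ) : ZMod (2 * n)) = 0 → d = 0 := by
    intro d hd h
    rw [ZMod.intCast_zmod_eq_zero_iff_dvd] at h
    refine Int.eq_zero_of_abs_lt_dvd h (abs_lt.2 ?_)
    push_cast; omega
  have hinj : ∀ a b : ℤ, a ≠ b → (-10 < a - b ∧ a - b < 10) →
      (-(a : ZMod (2 * n))) ≠ -(b : ZMod (2 * n)) := by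
    intro a b hab hd h
    have := hcast (a - b) hd (by push_cast; linear_combination -h)
    omega
  have hodd : ∀ k : ℤ, Odd k → Odd ((k : ZMod (2 * n))).val := by
    intro k hk
    have h := ZMod.val_intCast (n := 2 * n) k
    have h2 : (((k : ZMod (2 * n)).val : ℕ) : ℤ) % 2 = 1 := by
      rw [h, Int.emod_emod_of_dvd _ (by push_cast; exact dvd_mul_right _ _)]
      exact Int.odd_iff.1 hk
    rw [Nat.odd_iff]; omega
  set y : ℤ → Pt := fun i => x (-(i : ZMod (2 * n))) with hy
  set s : ℤ → Pt := fun k => r (k : ZMod (2 * n)) with hs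
  have hyy : ∀ a b c : ℤ, a ≠ b → b ≠ c → a ≠ c → (-10 < a - b ∧ a - b < 10) → (-10 < b - c ∧ b - c < 10) → (-10 < a - c ∧ a - c < 10) →
      det3 (y a) (y b) (y c) ≠ 0 := fun a b c h1 h2 h3 d1 d2 d3 =>
    no_three hxinj hconv (hinj _ _ h1 d1) (hinj _ _ h2 d2) (hinj _ _ h3 d3)
  have hys : ∀ a b k : ℤ, Odd k → a ≠ b → (-10 < a - b ∧ a - b < 10) → (-10 < a + b - k ∧ a + b - k < 10) →
      (det3 (y a) (y b) (s k) = 0 ↔ a + b = k) := by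
    intro a b k hk hab hd hd'
    rw [← collinear_iff_det3 (hxinj.ne (hinj a b hab hd)),
      hcol _ _ _ (hinj a b hab hd) (hodd k hk)]
    constructor
    · intro h
      have := hcast (a + b - k) hd' (by push_cast; linear_combination -h)
      omega
    · rintro rfl
      push_cast; ring
  obtain ⟨c, hc0, hc⟩ := exists_cubic ![y 0, y 1, y 2, y 3, y 4, y 5, y 6, s 3, s 5]
  have hprop := propagate (F := cubEval c) ⟨c, fun _ => rfl⟩ hyy hys
    (by
      intro j h0 h6
      interval_cases j
      · exact hc 0
      · exact hc 1
      · exact hc 2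
      · exact hc 3
      · exact hc 4
      · exact hc 5
      · exact hc 6) (hc 7) (hc 8)
  refine ⟨toMv c, toMv_ne c hc0, toMv_deg c, ?_, ?_⟩
  · intro i
    rw [toMv_eval]
    have := (hprop (-i).val).1 0 (by norm_num) (by norm_num)
    simpa [hy] using this
  · intro k hk
    rw [toMv_eval]
    obtain ⟨u, hu⟩ := hk
    have := (hprop (u + n - 1)).2.1
    have e : (2 * ((u + n - 1 : ℕ) : ℤ) + 3) = ((k.val + 2 * n : ℕ) : ℤ) := by
      push_cast; omega
    rw [e] at this
    simp only [hs, Int.cast_natCast] at this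
    rw [Nat.cast_add, ZMod.natCast_self, add_zero, ZMod.natCast_zmod_val] at this
    exact this
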